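/- arXiv:1610.08731 — 3 statements merged into one kernel-verified Lean document; each statement's English description precedes it below -/
import Mathlib

section
/- With I(α) = ∫₀¹ r^α e^{-1/r} dr, for every integer j ≥ 2 and every real p with p > 2 + 2/j, the quantity [I(-2jk+1)]^p · I(-(j+1)pk+1) / ( [I(-2(j+1)k+1)]^p · I(-(j-1)pk+1) ) tends to +∞ as the positive integer k tends to infinity. -/
open MeasureTheory Filter

/-- `I(α) = ∫₀¹ r^α e^{-1/r} dr`. -/
noncomputable def Iw (α : ℝ) : ℝ := ∫ r in Set.Ioo (0:ℝ) 1, r ^ α * Real.exp (-(1/r))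

open scoped Topology

/-- On `(0,1)` the integrand of `Iw (-s + 1)` is at most `(s/e)^s`. -/
lemma integrand_le {s r : ℝ} (hs : 0 < s) (hr : r ∈ Set.Ioo (0:ℝ) 1) :
    r ^ (-s + 1) * Real.exp (-(1/r)) ≤ Real.exp (s * Real.log s - s) := by
  obtain ⟨h0, h1⟩ := hr
  rw [Real.rpow_def_of_pos h0, ← Real.exp_add, Real.exp_le_exp]
  have hlr : Real.log r ≤ 0 := Real.log_nonpos h0.le h1.le
  have h : Real.log (1 / r / s) ≤ 1 / r / s - 1 := Real.log_le_sub_one_of_pos (by positivity)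
  rw [Real.log_div (by positivity) hs.ne', one_div, Real.log_inv] at h
  have h2 := mul_le_mul_of_nonneg_left h hs.le
  have h3 : s * (r⁻¹ / s - 1) = r⁻¹ - s := by field_simp
  rw [h3] at h2
  rw [one_div]
  nlinarith

lemma integrableOn_integrand {s : ℝ} (hs : 0 < s) :
    IntegrableOn (fun r : ℝ => r ^ (-s + 1) * Real.exp (-(1/r))) (Set.Ioo (0:ℝ) 1) := by
  refine IntegrableOn.of_bound (C := Real.exp (s * Real.log s - s)) (by simp) ?_ ?_
  · exact (by fun_prop : Measurable fun r : ℝ =>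
      r ^ (-s + 1) * Real.exp (-(1/r))).aestronglyMeasurable
  · filter_upwards [ae_restrict_mem measurableSet_Ioo] with r hr
    rw [Real.norm_of_nonneg (mul_nonneg (Real.rpow_nonneg hr.1.le _) (Real.exp_pos _).le)]
    exact integrand_le hs hr

lemma Iw_le {s : ℝ} (hs : 0 < s) : Iw (-s + 1) ≤ Real.exp (s * Real.log s - s) := by
  have h := setIntegral_mono_on (integrableOn_integrand hs)
    (integrableOn_const (C := Real.exp (s * Real.log s - s)) (by simp)) measurableSet_Ioo
    (fun r hr => integrand_le hs hr)
  simpa [Iw] using h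

lemma le_Iw {s : ℝ} (hs : 1 ≤ s) :
    Real.exp (s * Real.log s - s - 1 - 3 * Real.log (s + 1)) ≤ Iw (-s + 1) := by
  have hs0 : 0 < s := by linarith
  have hsub : Set.Ioo (1 / (s + 1)) (1 / s) ⊆ Set.Ioo (0:ℝ) 1 := by
    intro r hr
    refine ⟨lt_trans (by positivity) hr.1, hr.2.trans_le ?_⟩
    rw [div_le_one hs0]
    exact hs
  have hI := integrableOn_integrand hs0
  have hmono : ∫ r in Set.Ioo (1 / (s + 1)) (1 / s), r ^ (-s + 1) * Real.exp (-(1/r))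
      ≤ Iw (-s + 1) := by
    refine setIntegral_mono_set hI ?_ hsub.eventuallyLE
    filter_upwards [ae_restrict_mem measurableSet_Ioo] with r hr
    exact mul_nonneg (Real.rpow_nonneg hr.1.le _) (Real.exp_pos _).le
  have hconst := setIntegral_mono_on
    (integrableOn_const (C := Real.exp ((s - 1) * Real.log s - (s + 1)))
      (s := Set.Ioo (1 / (s + 1)) (1 / s)) (μ := volume) (by simp)) (hI.mono_set hsub)
    measurableSet_Ioo (fun r hr => by
      have h0 : 0 < r := (hsub hr).1
      rw [Real.rpow_def_of_pos h0, ← Real.exp_add, Real.exp_le_exp]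
      have h1 : 1 / r ≤ s + 1 := by
        rw [div_le_iff₀ h0]
        have := (div_lt_iff₀ (by positivity)).1 hr.1
        linarith
      have h2 : s ≤ 1 / r := by
        rw [le_div_iff₀ h0]
        have := (lt_div_iff₀ hs0).1 hr.2
        linarith
      have h3 := Real.log_le_log hs0 h2
      rw [one_div, Real.log_inv] at h3
      nlinarith)
  refine le_trans ?_ (hconst.trans hmono)
  have hlen : 1 / s - 1 / (s + 1) = Real.exp (-Real.log s - Real.log (s + 1)) := by
    rw [Real.exp_sub, Real.exp_neg, Real.exp_log hs0,
      Real.exp_log (by linarith)]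
    field_simp
    ring
  have hlen0 : 1 / (s + 1) ≤ 1 / s := one_div_le_one_div_of_le hs0 (by linarith)
  rw [setIntegral_const, Real.volume_real_Ioo_of_le hlen0, hlen, smul_eq_mul, ← Real.exp_add,
    Real.exp_le_exp]
  have := Real.log_le_log hs0 (by linarith : s ≤ s + 1)
  nlinarith

lemma Iw_pos {s : ℝ} (hs : 1 ≤ s) : 0 < Iw (-s + 1) :=
  (Real.exp_pos _).trans_le (le_Iw hs)

lemma eventually_one_le_mul {c : ℝ} (hc : 0 < c) : ∀ᶠ k : ℕ in atTop, 1 ≤ c * (k : ℝ) :=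
  (tendsto_natCast_atTop_atTop.const_mul_atTop hc).eventually_ge_atTop 1

lemma tendsto_log_Iw {c : ℝ} (hc : 0 < c) :
    Tendsto (fun k : ℕ => (Real.log (Iw (-(c * k) + 1)) - c * k * Real.log k) / k) atTop
      (𝓝 (c * Real.log c - c)) := by
  have hlog : Tendsto (fun k : ℕ => Real.log (k : ℝ) / k) atTop (𝓝 0) :=
    (Real.isLittleO_log_id_atTop.tendsto_div_nhds_zero).comp tendsto_natCast_atTop_atTop
  have hinv : Tendsto (fun k : ℕ => 1 / (k : ℝ)) atTop (𝓝 0) :=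
    tendsto_one_div_atTop_nhds_zero_nat
  have hlow : Tendsto (fun k : ℕ => c * Real.log c - c
      - ((1 + 3 * Real.log (c + 1)) * (1 / (k : ℝ)) + 3 * (Real.log (k : ℝ) / k))) atTop
      (𝓝 (c * Real.log c - c)) := by
    simpa using ((hinv.const_mul (1 + 3 * Real.log (c + 1))).add (hlog.const_mul 3)).const_sub
      (c * Real.log c - c)
  refine tendsto_of_tendsto_of_tendsto_of_le_of_le' hlow tendsto_const_nhds ?_ ?_
  · filter_upwards [eventually_one_le_mul hc, eventually_ge_atTop 1] with k hk hk1
    have hk1' : (1:ℝ) ≤ k := by exact_mod_cast hk1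
    have hk0 : (0:ℝ) < k := by linarith
    have h := (Real.le_log_iff_exp_le (Iw_pos hk)).2 (le_Iw hk)
    have h2 : Real.log (c * k + 1) ≤ Real.log (c + 1) + Real.log k := by
      rw [← Real.log_mul (by positivity) hk0.ne']
      exact Real.log_le_log (by positivity) (by linarith)
    rw [Real.log_mul hc.ne' hk0.ne'] at h
    rw [le_div_iff₀ hk0]
    have h3 : (c * Real.log c - c - ((1 + 3 * Real.log (c + 1)) * (1 / (k : ℝ))
        + 3 * (Real.log (k : ℝ) / k))) * k
        = (c * Real.log c - c) * k - (1 + 3 * Real.log (c + 1)) - 3 * Real.log k := by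
      field_simp
      ring
    rw [h3]
    nlinarith
  · filter_upwards [eventually_one_le_mul hc, eventually_ge_atTop 1] with k hk hk1
    have hk0 : (0:ℝ) < k := by exact_mod_cast hk1
    have h := (Real.log_le_iff_le_exp (Iw_pos hk)).2 (Iw_le (by linarith))
    rw [Real.log_mul hc.ne' hk0.ne'] at h
    rw [div_le_iff₀ hk0]
    nlinarith

/-- Positivity of the exponential growth rate of the ratio. -/
lemma growth_rate_pos {x p : ℝ} (hx : 2 ≤ x) (hp : 2 + 2 / x < p) :
    0 < p * (2 * x * Real.log (2 * x) - 2 * x)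
      + ((x + 1) * p * Real.log ((x + 1) * p) - (x + 1) * p)
      - p * (2 * (x + 1) * Real.log (2 * (x + 1)) - 2 * (x + 1))
      - ((x - 1) * p * Real.log ((x - 1) * p) - (x - 1) * p) := by
  have hx0 : 0 < x := by linarith
  have hx1 : 0 < x - 1 := by linarith
  have hp0 : 0 < p := lt_trans (by positivity) hp
  have h1 : Real.log 2 + Real.log (x + 1) < Real.log p + Real.log x := by
    rw [← Real.log_mul (by norm_num) (by positivity), ← Real.log_mul hp0.ne' hx0.ne']
    refine Real.log_lt_log (by positivity) ?_
    have := mul_lt_mul_of_pos_right hp hx0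
    have h : (2 + 2 / x) * x = 2 * (x + 1) := by field_simp
    linarith
  have h2 : Real.log (x + 1) + Real.log (x - 1) < 2 * Real.log x := by
    rw [← Real.log_mul (by positivity) hx1.ne', two_mul, ← Real.log_mul hx0.ne' hx0.ne']
    exact Real.log_lt_log (by positivity) (by nlinarith)
  rw [Real.log_mul (by norm_num) hx0.ne', Real.log_mul (by positivity) hp0.ne',
    Real.log_mul (by norm_num) (by positivity), Real.log_mul hx1.ne' hp0.ne']
  have h3 := mul_pos hp0 (add_pos (mul_pos two_pos (sub_pos.2 h1)) (mul_pos hx1 (sub_pos.2 h2)))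
  linarith

/-- For `j ≥ 2` and `p > 2 + 2/j`, the ratio
`[I(-2jk+1)]^p · I(-(j+1)pk+1) / ([I(-2(j+1)k+1)]^p · I(-(j-1)pk+1))` blows up as `k → ∞`. -/
theorem ratio_blowup_lambda (j : ℕ) (hj : 2 ≤ j) (p : ℝ) (hp : 2 + 2/(j:ℝ) < p) :
    Tendsto (fun k : ℕ =>
        (Iw (-(2*(j:ℝ)*k) + 1)) ^ p * Iw (-(((j:ℝ)+1)*p*k) + 1) /
          ((Iw (-(2*((j:ℝ)+1)*k) + 1)) ^ p * Iw (-((((j:ℝ)-1))*p*k) + 1)))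
      atTop atTop := by
  have hx : (2:ℝ) ≤ j := by exact_mod_cast hj
  generalize (j:ℝ) = x at hx hp ⊢
  have hx1 : 0 < x - 1 := by linarith
  have hp0 : 0 < p := lt_trans (by positivity) hp
  have ha : 0 < 2 * x := by positivity
  have hb : 0 < (x + 1) * p := by positivity
  have hc : 0 < 2 * (x + 1) := by positivity
  have hd : 0 < (x - 1) * p := by positivity
  have hlim := ((((tendsto_log_Iw ha).const_mul p).add (tendsto_log_Iw hb)).sub
    ((tendsto_log_Iw hc).const_mul p)).sub (tendsto_log_Iw hd)
  have hexp := Real.tendsto_exp_atTop.comp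
    (hlim.pos_mul_atTop (growth_rate_pos hx hp) tendsto_natCast_atTop_atTop)
  refine hexp.congr' ?_
  filter_upwards [eventually_one_le_mul ha, eventually_one_le_mul hb, eventually_one_le_mul hc,
    eventually_one_le_mul hd, eventually_ge_atTop 1] with k hka hkb hkc hkd hk1
  have hk0 : (0:ℝ) < k := by exact_mod_cast hk1
  have hA := Iw_pos hka
  have hB := Iw_pos hkb
  have hC := Iw_pos hkc
  have hD := Iw_pos hkd
  have hlog : ∀ {A B C D : ℝ}, 0 < A → 0 < B → 0 < C → 0 < D →
      A ^ p * B / (C ^ p * D)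
        = Real.exp (p * Real.log A + Real.log B - p * Real.log C - Real.log D) := by
    intro A B C D hA hB hC hD
    rw [Real.exp_sub, Real.exp_sub, Real.exp_add, Real.exp_log hB, Real.exp_log hD,
      Real.rpow_def_of_pos hA, Real.rpow_def_of_pos hC, mul_comm p, mul_comm p, div_div]
  rw [hlog hA hB hC hD, Function.comp_apply]
  congr 1
  field_simp
  ring
end

section
/- Let Γ denote the Gamma function. For every integer j ≥ 2 and every real p with p > 2 + 2/j, the quantity [Γ(2jk-2)]^p · Γ((j+1)pk-2) / ( [Γ(2(j+1)k-2)]^p · Γ((j-1)pk-2) ) tends to +∞ as the positive integer k tends to infinity. -/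
open Filter

/-- The tangent-line inequality for the convex function `x ↦ x log x - x`. -/
lemma mul_log_sub_self_sub_le {x y : ℝ} (hx : 0 < x) (hy : 0 < y) :
    (x * Real.log x - x) - (y * Real.log y - y) ≤ (x - y) * Real.log x := by
  have h := Real.log_le_sub_one_of_pos (div_pos hx hy)
  rw [Real.log_div hx.ne' hy.ne'] at h
  have h2 := mul_le_mul_of_nonneg_left h hy.le
  have h3 : y * (x / y - 1) = x - y := by field_simp
  linarith

lemma log_factorial_le_stirling {n : ℕ} (hn : n ≠ 0) :
    Real.log n.factorial ≤ n * Real.log n - n + Real.log n + 1 := by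
  obtain ⟨m, rfl⟩ := Nat.exists_eq_succ_of_ne_zero hn
  have h : Real.log (Stirling.stirlingSeq (m + 1)) ≤ Real.log (Stirling.stirlingSeq (0 + 1)) :=
    Stirling.log_stirlingSeq'_antitone (Nat.zero_le m)
  rw [Stirling.log_stirlingSeq_formula, Stirling.log_stirlingSeq_formula,
    Real.log_div (by positivity) (by positivity), Real.log_mul (by norm_num) (by positivity)] at h
  have h0 : 0 ≤ Real.log ((m + 1 : ℕ) : ℝ) := Real.log_natCast_nonneg _
  simp only [Real.log_exp, zero_add, Nat.factorial_one, Nat.cast_one, Real.log_one, mul_one,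
    Real.log_div one_ne_zero (Real.exp_ne_zero 1)] at h
  rw [Nat.succ_eq_add_one]
  linarith

lemma abs_log_Gamma_sub_two_sub_le {x : ℝ} (hx : 4 ≤ x) :
    |Real.log (Real.Gamma (x - 2)) - (x * Real.log x - x)| ≤ 4 * Real.log x + 1 := by
  set n := ⌊x - 2⌋₊ with hn
  have hn2 : 2 ≤ n := Nat.le_floor (by push_cast; linarith)
  have hn2' : (2 : ℝ) ≤ n := by exact_mod_cast hn2
  have hle : (n : ℝ) ≤ x - 2 := Nat.floor_le (by linarith)
  have hlt : x - 2 < n + 1 := Nat.lt_floor_add_one _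
  have hlogn : 0 ≤ Real.log n := Real.log_natCast_nonneg _
  have hlog : Real.log n ≤ Real.log x := Real.log_le_log (by linarith) (by linarith)
  have hG : 0 < Real.Gamma (x - 2) := Real.Gamma_pos_of_pos (by linarith)
  have hmono := Real.Gamma_strictMonoOn_Ici.monotoneOn
  have hup : Real.log (Real.Gamma (x - 2)) ≤ Real.log n.factorial := by
    rw [← Real.Gamma_nat_eq_factorial]
    exact Real.log_le_log hG (hmono (Set.mem_Ici.2 (by linarith)) (Set.mem_Ici.2 (by linarith))
      hlt.le)
  have hlo : Real.log n.factorial ≤ Real.log (Real.Gamma (x - 2)) + Real.log n := by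
    have hGn : 0 < Real.Gamma n := Real.Gamma_pos_of_pos (by linarith)
    have h := Real.log_le_log hGn
      (hmono (Set.mem_Ici.2 hn2') (Set.mem_Ici.2 (by linarith)) hle)
    rw [← Real.Gamma_nat_eq_factorial, Real.Gamma_add_one (by linarith),
      Real.log_mul (by linarith) hGn.ne']
    linarith
  have h1 := log_factorial_le_stirling (n := n) (by omega)
  have h2 := Stirling.le_log_factorial_stirling (n := n) (by omega)
  have h3 : 0 ≤ Real.log (2 * Real.pi) :=
    Real.log_nonneg (by linarith [Real.pi_gt_three])
  have h4 := mul_log_sub_self_sub_le (x := x) (y := n) (by linarith) (by linarith)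
  have h5 := mul_log_sub_self_sub_le (x := n) (y := x) (by linarith) (by linarith)
  have h6 : (x - n) * Real.log x ≤ 3 * Real.log x := by
    gcongr
    · linarith
    · linarith
  have h7 : (n - x) * Real.log n ≤ 0 := mul_nonpos_of_nonpos_of_nonneg (by linarith) hlogn
  rw [abs_le]
  constructor <;> linarith

lemma log_Gamma_sub_two_sub_isLittleO :
    (fun x : ℝ => Real.log (Real.Gamma (x - 2)) - (x * Real.log x - x)) =o[atTop] id := by
  have hO : (fun x : ℝ => Real.log (Real.Gamma (x - 2)) - (x * Real.log x - x)) =O[atTop]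
      (fun x : ℝ => 4 * Real.log x + 1) := by
    refine Asymptotics.IsBigO.of_bound 1 ?_
    filter_upwards [eventually_ge_atTop 4] with x hx
    rw [one_mul, Real.norm_eq_abs, Real.norm_eq_abs]
    exact (abs_log_Gamma_sub_two_sub_le hx).trans (le_abs_self _)
  refine hO.trans_isLittleO ((Real.isLittleO_log_id_atTop.const_mul_left 4).add ?_)
  exact Asymptotics.isLittleO_const_id_atTop 1

lemma tendsto_log_Gamma_mul_sub_two {a : ℝ} (ha : 0 < a) :
    Tendsto (fun k : ℕ => Real.log (Real.Gamma (a * k - 2)) / k - a * Real.log k)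
      atTop (nhds (a * Real.log a - a)) := by
  have hak : Tendsto (fun k : ℕ => a * (k : ℝ)) atTop atTop :=
    tendsto_natCast_atTop_atTop.const_mul_atTop ha
  have h := (log_Gamma_sub_two_sub_isLittleO.tendsto_div_nhds_zero.comp hak).const_mul a
  have h' := h.add_const (a * Real.log a - a)
  rw [mul_zero, zero_add] at h'
  refine h'.congr' ?_
  filter_upwards [eventually_gt_atTop 0] with k hk
  have hk' : (0 : ℝ) < k := by exact_mod_cast hk
  simp only [Function.comp, id]
  rw [Real.log_mul ha.ne' hk'.ne']
  field_simp
  ring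

lemma gamma_ratio_rate_pos {j p : ℝ} (hj : 2 ≤ j) (hp : 2 + 2 / j < p) :
    0 < p * (2 * j * Real.log (2 * j) - 2 * j)
      + ((j + 1) * p * Real.log ((j + 1) * p) - (j + 1) * p)
      - p * (2 * (j + 1) * Real.log (2 * (j + 1)) - 2 * (j + 1))
      - ((j - 1) * p * Real.log ((j - 1) * p) - (j - 1) * p) := by
  have hj0 : 0 < j := by linarith
  have hj1 : 0 < j - 1 := by linarith
  have hp0 : 0 < p := lt_trans (by positivity) hp
  have h1 : Real.log 2 + Real.log (j + 1) < Real.log p + Real.log j := by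
    rw [← Real.log_mul two_ne_zero (by positivity), ← Real.log_mul hp0.ne' hj0.ne']
    refine Real.log_lt_log (by positivity) ?_
    have h := mul_lt_mul_of_pos_right hp hj0
    have : (2 + 2 / j) * j = 2 * (j + 1) := by field_simp
    linarith
  have h2 : Real.log (j + 1) + Real.log (j - 1) < Real.log j + Real.log j := by
    rw [← Real.log_mul (by positivity) hj1.ne', ← Real.log_mul hj0.ne' hj0.ne']
    exact Real.log_lt_log (by positivity) (by nlinarith)
  have h3 := mul_pos hj1 (sub_pos.2 h2)
  have h4 : 0 < p * (2 * (Real.log p + Real.log j - (Real.log 2 + Real.log (j + 1)))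
      + (j - 1) * (Real.log j + Real.log j - (Real.log (j + 1) + Real.log (j - 1)))) :=
    mul_pos hp0 (by linarith)
  rw [Real.log_mul two_ne_zero hj0.ne', Real.log_mul two_ne_zero (by positivity),
    Real.log_mul (by positivity) hp0.ne', Real.log_mul hj1.ne' hp0.ne']
  convert h4 using 1
  ring

/-- For `j ≥ 2` and `p > 2 + 2/j`, the ratio
`[Γ(2jk-2)]^p · Γ((j+1)pk-2) / ([Γ(2(j+1)k-2)]^p · Γ((j-1)pk-2))` blows up as `k → ∞`. -/
theorem gamma_ratio_blowup (j : ℕ) (hj : 2 ≤ j) (p : ℝ) (hp : 2 + 2/(j:ℝ) < p) :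
    Tendsto (fun k : ℕ =>
        (Real.Gamma (2*(j:ℝ)*k - 2)) ^ p * Real.Gamma (((j:ℝ)+1)*p*k - 2) /
          ((Real.Gamma (2*((j:ℝ)+1)*k - 2)) ^ p * Real.Gamma (((j:ℝ)-1)*p*k - 2)))
      atTop atTop := by
  have hj2 : (2 : ℝ) ≤ j := by exact_mod_cast hj
  have hp0 : 0 < p := lt_trans (by positivity) hp
  have hj1 : (0 : ℝ) < j - 1 := by linarith
  have ha : 0 < 2 * (j : ℝ) := by positivity
  have hb : 0 < ((j : ℝ) + 1) * p := by positivity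
  have hc : 0 < 2 * ((j : ℝ) + 1) := by positivity
  have hd : 0 < ((j : ℝ) - 1) * p := by positivity
  have hlim := ((((tendsto_log_Gamma_mul_sub_two ha).const_mul p).add
    (tendsto_log_Gamma_mul_sub_two hb)).sub ((tendsto_log_Gamma_mul_sub_two hc).const_mul p)).sub
    (tendsto_log_Gamma_mul_sub_two hd)
  have hexp := Real.tendsto_exp_atTop.comp
    (hlim.pos_mul_atTop (gamma_ratio_rate_pos hj2 hp) (tendsto_natCast_atTop_atTop (R := ℝ)))
  have hpos : ∀ {a : ℝ}, 0 < a → ∀ᶠ k : ℕ in atTop, 0 < Real.Gamma (a * k - 2) := fun h => by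
    filter_upwards [(tendsto_natCast_atTop_atTop.const_mul_atTop h).eventually_gt_atTop 2]
      with k hk
    exact Real.Gamma_pos_of_pos (sub_pos.2 hk)
  refine hexp.congr' ?_
  filter_upwards [eventually_gt_atTop 0, hpos ha, hpos hb, hpos hc, hpos hd] with k hk h1 h2 h3 h4
  have hk' : (k : ℝ) ≠ 0 := by exact_mod_cast hk.ne'
  have h1p := Real.rpow_pos_of_pos h1 p
  have h3p := Real.rpow_pos_of_pos h3 p
  rw [← Real.exp_log (div_pos (mul_pos h1p h2) (mul_pos h3p h4)),
    Real.log_div (mul_pos h1p h2).ne' (mul_pos h3p h4).ne', Real.log_mul h1p.ne' h2.ne',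
    Real.log_mul h3p.ne' h4.ne', Real.log_rpow h1, Real.log_rpow h3]
  simp only [Function.comp]
  congr 1
  field_simp
  ring
end

section
/- With I(α) = ∫₀¹ r^α e^{-1/r} dr, there exists a constant C ≥ 1 such that for every r ∈ (0,1) the two-sided bound (1/C) · ( r^{-3} sinh(1/r) + (1-r²)^{-2} ) ≤ Σ_{k ∈ ℤ} r^{2k} / I(2k+1) ≤ C · ( r^{-3} sinh(1/r) + (1-r²)^{-2} ) holds, the series over k ∈ ℤ being convergent for each r ∈ (0,1). -/
open MeasureTheory

/-- The substitution `r = 1/t` in the integral defining `Iw`. -/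
lemma Iw_eq_integral_Ioi (α : ℝ) :
    Iw α = ∫ t in Set.Ioi (1:ℝ), t ^ (-α - 2) * Real.exp (-t) := by
  have himg : (fun t : ℝ => t⁻¹) '' Set.Ioi 1 = Set.Ioo 0 1 := by
    ext x
    constructor
    · rintro ⟨t, ht, rfl⟩
      have ht' : (1:ℝ) < t := ht
      exact ⟨inv_pos.2 (by linarith), inv_lt_one_of_one_lt₀ ht'⟩
    · rintro ⟨h0, h1⟩
      exact ⟨x⁻¹, (one_lt_inv₀ h0).2 h1, inv_inv x⟩
  have hderiv : ∀ t ∈ Set.Ioi (1:ℝ),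
      HasDerivWithinAt (fun t : ℝ => t⁻¹) (-(t ^ 2)⁻¹) (Set.Ioi 1) t := by
    intro t ht
    have ht' : (1:ℝ) < t := ht
    exact (hasDerivAt_inv (by linarith)).hasDerivWithinAt
  rw [Iw, ← himg, integral_image_eq_integral_abs_deriv_smul measurableSet_Ioi hderiv
    (inv_injective.injOn)]
  refine setIntegral_congr_fun measurableSet_Ioi fun t ht => ?_
  have ht' : (1:ℝ) < t := ht
  have ht0 : 0 < t := by linarith
  have hrpow : t ^ (-α - 2) = (t ^ 2)⁻¹ * (t⁻¹) ^ α := by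
    rw [Real.inv_rpow ht0.le, Real.rpow_sub ht0, Real.rpow_neg ht0.le, Real.rpow_two]
    ring
  simp only [smul_eq_mul, abs_neg, one_div, inv_inv]
  rw [abs_of_pos (by positivity), hrpow, mul_assoc]

lemma Iw_nonneg (α : ℝ) : 0 ≤ Iw α :=
  setIntegral_nonneg measurableSet_Ioo fun _ hr =>
    mul_nonneg (Real.rpow_nonneg hr.1.le α) (Real.exp_pos _).le

lemma setIntegral_Ioo_zero_one_pow (n : ℕ) :
    ∫ r in Set.Ioo (0:ℝ) 1, r ^ n = 1 / ((n:ℝ) + 1) := by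
  rw [← integral_Ioc_eq_integral_Ioo, ← intervalIntegral.integral_of_le zero_le_one,
    integral_pow]
  simp

lemma integrableOn_Ioo_zero_one_pow (n : ℕ) :
    IntegrableOn (fun r : ℝ => r ^ n) (Set.Ioo 0 1) :=
  ((continuous_pow n).integrableOn_Icc).mono_set Set.Ioo_subset_Icc_self

lemma Iw_natCast (n : ℕ) :
    Iw n = ∫ r in Set.Ioo (0:ℝ) 1, r ^ n * Real.exp (-(1/r)) := by
  simp only [Iw, Real.rpow_natCast]

lemma integrableOn_pow_mul_exp_neg_one_div (n : ℕ) :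
    IntegrableOn (fun r : ℝ => r ^ n * Real.exp (-(1/r))) (Set.Ioo 0 1) := by
  refine (integrableOn_Ioo_zero_one_pow n).mono' (by fun_prop) ?_
  filter_upwards [ae_restrict_mem measurableSet_Ioo] with r hr
  have hr0 : 0 < r := hr.1
  rw [Real.norm_of_nonneg (by positivity)]
  exact mul_le_of_le_one_right (by positivity)
    (Real.exp_le_one_iff.2 (neg_nonpos.2 (by positivity)))

lemma Iw_natCast_le (n : ℕ) : Iw n ≤ 1 / ((n:ℝ) + 1) := by
  rw [Iw_natCast, ← setIntegral_Ioo_zero_one_pow]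
  refine setIntegral_mono_on (integrableOn_pow_mul_exp_neg_one_div n)
    (integrableOn_Ioo_zero_one_pow n) measurableSet_Ioo fun r hr => ?_
  have hr0 : 0 < r := hr.1
  exact mul_le_of_le_one_right (by positivity)
    (Real.exp_le_one_iff.2 (neg_nonpos.2 (by positivity)))

lemma exp_neg_two_mul_le_exp_neg_one_div {r : ℝ} (h0 : 0 < r) (h1 : r < 1) :
    Real.exp (-2) * (2 * r - 1) ≤ Real.exp (-(1/r)) := by
  rcases le_total r (1/2) with h | h
  · exact (mul_nonpos_of_nonneg_of_nonpos (Real.exp_pos _).le (by linarith)).trans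
      (Real.exp_pos _).le
  · have h2 : 1 / r ≤ 2 := by
      rw [div_le_iff₀ h0]
      linarith
    exact (mul_le_of_le_one_right (Real.exp_pos _).le (by linarith)).trans
      (Real.exp_le_exp.2 (by linarith))

lemma le_Iw_natCast {n : ℕ} (hn : 1 ≤ n) :
    Real.exp (-2) / (3 * ((n:ℝ) + 1)) ≤ Iw n := by
  have hlow : ∫ r in Set.Ioo (0:ℝ) 1, Real.exp (-2) * (2 * r ^ (n + 1) - r ^ n)
      = Real.exp (-2) * (2 * (1 / ((n:ℝ) + 2)) - 1 / ((n:ℝ) + 1)) := by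
    rw [integral_const_mul, integral_sub ((integrableOn_Ioo_zero_one_pow _).const_mul 2)
      (integrableOn_Ioo_zero_one_pow _), integral_const_mul, setIntegral_Ioo_zero_one_pow,
      setIntegral_Ioo_zero_one_pow]
    push_cast
    ring
  have hn' : (1:ℝ) ≤ n := by exact_mod_cast hn
  calc Real.exp (-2) / (3 * ((n:ℝ) + 1))
      ≤ Real.exp (-2) * (2 * (1 / ((n:ℝ) + 2)) - 1 / ((n:ℝ) + 1)) := by
        rw [div_eq_mul_one_div]
        refine mul_le_mul_of_nonneg_left ?_ (Real.exp_pos _).le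
        have : 2 * (1 / ((n:ℝ) + 2)) - 1 / ((n:ℝ) + 1) - 1 / (3 * ((n:ℝ) + 1))
            = (2 * n - 2) / (3 * ((n:ℝ) + 1) * (n + 2)) := by
          field_simp
          ring
        have h : 0 ≤ (2 * n - 2) / (3 * ((n:ℝ) + 1) * (n + 2)) :=
          div_nonneg (by linarith) (by positivity)
        linarith
    _ ≤ Iw n := by
        rw [Iw_natCast, ← hlow]
        refine setIntegral_mono_on ((((integrableOn_Ioo_zero_one_pow _).const_mul 2).sub
          (integrableOn_Ioo_zero_one_pow _)).const_mul _)
          (integrableOn_pow_mul_exp_neg_one_div n) measurableSet_Ioo fun r hr => ?_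
        calc Real.exp (-2) * (2 * r ^ (n + 1) - r ^ n)
            = r ^ n * (Real.exp (-2) * (2 * r - 1)) := by ring
          _ ≤ _ := mul_le_mul_of_nonneg_left
            (exp_neg_two_mul_le_exp_neg_one_div hr.1 hr.2) (pow_nonneg hr.1.le n)

lemma Iw_neg_natCast_sub_two (n : ℕ) :
    Iw (-(n:ℝ) - 2) = ∫ t in Set.Ioi (1:ℝ), t ^ n * Real.exp (-t) := by
  rw [Iw_eq_integral_Ioi]
  have : -(-(n:ℝ) - 2) - 2 = n := by ring
  simp only [this, Real.rpow_natCast]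

lemma integrableOn_Ioi_pow_mul_exp_neg (n : ℕ) :
    IntegrableOn (fun t : ℝ => t ^ n * Real.exp (-t)) (Set.Ioi 0) := by
  have h := Real.GammaIntegral_convergent (s := (n:ℝ) + 1) (by positivity)
  simpa only [add_sub_cancel_right, Real.rpow_natCast, mul_comm] using h

lemma setIntegral_Ioi_pow_mul_exp_neg (n : ℕ) :
    ∫ t in Set.Ioi (0:ℝ), t ^ n * Real.exp (-t) = n.factorial := by
  rw [← Real.Gamma_nat_eq_factorial, Real.Gamma_eq_integral (by positivity)]
  simp only [add_sub_cancel_right, Real.rpow_natCast, mul_comm]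

lemma Iw_neg_natCast_sub_two_le (n : ℕ) : Iw (-(n:ℝ) - 2) ≤ n.factorial := by
  rw [Iw_neg_natCast_sub_two, ← setIntegral_Ioi_pow_mul_exp_neg]
  refine setIntegral_mono_set (integrableOn_Ioi_pow_mul_exp_neg n) ?_
    (Set.Ioi_subset_Ioi zero_le_one).eventuallyLE
  filter_upwards [ae_restrict_mem measurableSet_Ioi] with t ht
  exact mul_nonneg (pow_nonneg (le_of_lt ht) n) (Real.exp_pos _).le

lemma le_Iw_neg_natCast_sub_two {n : ℕ} (hn : 1 ≤ n) :
    (n.factorial : ℝ) / 2 ≤ Iw (-(n:ℝ) - 2) := by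
  have hint := integrableOn_Ioi_pow_mul_exp_neg n
  have hsplit : (n.factorial : ℝ) = (∫ t in Set.Ioc (0:ℝ) 1, t ^ n * Real.exp (-t))
      + ∫ t in Set.Ioi (1:ℝ), t ^ n * Real.exp (-t) := by
    rw [← setIntegral_Ioi_pow_mul_exp_neg, ← Set.Ioc_union_Ioi_eq_Ioi (zero_le_one' ℝ),
      setIntegral_union (Set.Ioc_disjoint_Ioi le_rfl) measurableSet_Ioi
        (hint.mono_set Set.Ioc_subset_Ioi_self)
        (hint.mono_set (Set.Ioi_subset_Ioi zero_le_one))]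
  have hsmall : ∫ t in Set.Ioc (0:ℝ) 1, t ^ n * Real.exp (-t) ≤ 1 / ((n:ℝ) + 1) := by
    rw [integral_Ioc_eq_integral_Ioo, ← setIntegral_Ioo_zero_one_pow]
    refine setIntegral_mono_on (hint.mono_set Set.Ioo_subset_Ioi_self)
      (integrableOn_Ioo_zero_one_pow n) measurableSet_Ioo fun t ht => ?_
    exact mul_le_of_le_one_right (pow_nonneg ht.1.le n)
      (Real.exp_le_one_iff.2 (neg_nonpos.2 ht.1.le))
  have hn' : (1:ℝ) ≤ n := by exact_mod_cast hn
  have hhalf : 1 / ((n:ℝ) + 1) ≤ 1 / 2 :=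
    one_div_le_one_div_of_le two_pos (by linarith)
  have hfac : (1:ℝ) ≤ n.factorial := by exact_mod_cast n.factorial_pos
  rw [Iw_neg_natCast_sub_two]
  linarith

lemma hasSum_two_mul_add_two_mul_pow {r : ℝ} (h0 : 0 < r) (h1 : r < 1) :
    HasSum (fun k : ℕ => r ^ (2 * k) * (2 * (k:ℝ) + 2)) (2 * (1 - r ^ 2) ^ (-2 : ℤ)) := by
  have hx : r ^ 2 < 1 := by nlinarith
  have hne : 1 - r ^ 2 ≠ 0 := by linarith
  have hs := ((hasSum_coe_mul_geometric_of_norm_lt_one (r := r ^ 2)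
    (by rwa [Real.norm_of_nonneg (by positivity)])).add
    (hasSum_geometric_of_lt_one (by positivity) hx)).mul_left 2
  have hterm : (fun k : ℕ => 2 * ((k:ℝ) * (r ^ 2) ^ k + (r ^ 2) ^ k))
      = fun k : ℕ => r ^ (2 * k) * (2 * (k:ℝ) + 2) := by
    ext k
    rw [pow_mul]
    ring
  have hval : 2 * (r ^ 2 / (1 - r ^ 2) ^ 2 + (1 - r ^ 2)⁻¹) = 2 * (1 - r ^ 2) ^ (-2 : ℤ) := by
    rw [zpow_neg, zpow_ofNat]
    field_simp
    ring
  rwa [hterm, hval] at hs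

/-- Termwise comparison for the nonnegative indices. -/
lemma kernel_term_nat_bounds {r : ℝ} (h0 : 0 < r) (k : ℕ) :
    r ^ (2 * k) * (2 * (k:ℝ) + 2) ≤ r ^ (2 * (k:ℤ)) / Iw (2 * ((k:ℤ):ℝ) + 1) ∧
    r ^ (2 * (k:ℤ)) / Iw (2 * ((k:ℤ):ℝ) + 1)
      ≤ 3 * Real.exp 2 * (r ^ (2 * k) * (2 * (k:ℝ) + 2)) := by
  have harg : 2 * ((k:ℤ):ℝ) + 1 = ((2 * k + 1 : ℕ) : ℝ) := by push_cast; ring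
  have hpow : r ^ (2 * (k:ℤ)) = r ^ (2 * k) := by
    exact_mod_cast zpow_natCast r (2 * k)
  have hup := Iw_natCast_le (2 * k + 1)
  have hlo := le_Iw_natCast (n := 2 * k + 1) (by omega)
  rw [harg, hpow]
  have hcast : ((2 * k + 1 : ℕ) : ℝ) + 1 = 2 * k + 2 := by push_cast; ring
  rw [hcast] at hup hlo
  have hpos : 0 < Iw ((2 * k + 1 : ℕ) : ℝ) := lt_of_lt_of_le (by positivity) hlo
  have hr : 0 < r ^ (2 * k) := by positivity
  constructor
  · rw [le_div_iff₀ hpos, mul_assoc]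
    refine mul_le_of_le_one_right hr.le ?_
    rwa [le_div_iff₀ (by positivity), mul_comm] at hup
  · rw [div_le_iff₀ hpos]
    have hone : 1 ≤ 3 * Real.exp 2 * (2 * (k:ℝ) + 2) * Iw ((2 * k + 1 : ℕ) : ℝ) := by
      rw [Real.exp_neg, div_le_iff₀ (by positivity), inv_le_iff_one_le_mul₀ (by positivity)] at hlo
      linarith
    nlinarith

/-- Termwise comparison for the indices `k ≤ -2`. -/
lemma kernel_term_neg_bounds {r : ℝ} (h0 : 0 < r) (n : ℕ) :
    r ^ (-3 : ℤ) * ((1/r) ^ (2 * n + 1) / (2 * n + 1).factorial)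
      ≤ r ^ (2 * (-((n + 1 : ℕ) + 1) : ℤ)) / Iw (2 * ((-((n + 1 : ℕ) + 1) : ℤ):ℝ) + 1) ∧
    r ^ (2 * (-((n + 1 : ℕ) + 1) : ℤ)) / Iw (2 * ((-((n + 1 : ℕ) + 1) : ℤ):ℝ) + 1)
      ≤ 2 * (r ^ (-3 : ℤ) * ((1/r) ^ (2 * n + 1) / (2 * n + 1).factorial)) := by
  have harg : 2 * ((-((n + 1 : ℕ) + 1) : ℤ):ℝ) + 1 = -((2 * n + 1 : ℕ) : ℝ) - 2 := by
    push_cast; ring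
  have hpow : r ^ (2 * (-((n + 1 : ℕ) + 1) : ℤ)) = r ^ (-3 : ℤ) * (1/r) ^ (2 * n + 1) := by
    rw [one_div, ← zpow_natCast, inv_zpow', ← zpow_add₀ h0.ne']
    congr 1
    push_cast
    ring
  have hup := Iw_neg_natCast_sub_two_le (2 * n + 1)
  have hlo := le_Iw_neg_natCast_sub_two (n := 2 * n + 1) (by omega)
  rw [harg, hpow, ← mul_div_assoc]
  have hfac : (0:ℝ) < (2 * n + 1).factorial := by exact_mod_cast Nat.factorial_pos _
  have hpos := lt_of_lt_of_le (half_pos hfac) hlo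
  have hr : 0 < r ^ (-3 : ℤ) * (1/r) ^ (2 * n + 1) := by positivity
  refine ⟨div_le_div_of_nonneg_left hr.le hpos hup, ?_⟩
  refine (div_le_div_of_nonneg_left hr.le (half_pos hfac) hlo).trans (le_of_eq ?_)
  field_simp

/-- Two-sided bound for the diagonal weighted Bergman kernel of the punctured disc:
`Σ_{k∈ℤ} r^{2k}/I(2k+1) ≈ r^{-3} sinh(1/r) + (1-r²)^{-2}` on `(0,1)`. -/
theorem kernel_diagonal_asymptotics :
    ∃ C : ℝ, 1 ≤ C ∧ ∀ r : ℝ, 0 < r → r < 1 →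
      Summable (fun k : ℤ => r ^ (2*k) / Iw (2*(k:ℝ) + 1)) ∧
      (1/C) * (r ^ (-3 : ℤ) * Real.sinh (1/r) + (1 - r^2) ^ (-2 : ℤ))
          ≤ ∑' k : ℤ, r ^ (2*k) / Iw (2*(k:ℝ) + 1) ∧
      ∑' k : ℤ, r ^ (2*k) / Iw (2*(k:ℝ) + 1)
          ≤ C * (r ^ (-3 : ℤ) * Real.sinh (1/r) + (1 - r^2) ^ (-2 : ℤ)) := by
  have hI := Iw_nonneg (-1)
  have he : 0 < Real.exp 2 := Real.exp_pos 2
  refine ⟨6 * Real.exp 2 + 2 + 1 / Iw (-1), ?_, fun r h0 h1 => ?_⟩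
  · have : 0 ≤ 1 / Iw (-1) := by positivity
    linarith
  set f : ℤ → ℝ := fun k => r ^ (2*k) / Iw (2*(k:ℝ) + 1) with hf
  set S : ℝ := r ^ (-3 : ℤ) * Real.sinh (1/r)
  set P : ℝ := (1 - r^2) ^ (-2 : ℤ)
  have hP : HasSum (fun k : ℕ => r ^ (2 * k) * (2 * (k:ℝ) + 2)) (2 * P) :=
    hasSum_two_mul_add_two_mul_pow h0 h1
  have hS : HasSum (fun n : ℕ => r ^ (-3 : ℤ) * ((1/r) ^ (2 * n + 1) / (2 * n + 1).factorial)) S :=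
    (Real.hasSum_sinh (1/r)).mul_left _
  have hfnonneg : ∀ k, 0 ≤ f k := fun k =>
    div_nonneg (zpow_nonneg h0.le _) (Iw_nonneg _)
  have hnat : Summable fun k : ℕ => f k :=
    Summable.of_nonneg_of_le (fun k => hfnonneg k) (fun k => (kernel_term_nat_bounds h0 k).2)
      (hP.summable.mul_left _)
  have hneg : Summable fun n : ℕ => f (-((n + 1 : ℕ) + 1)) :=
    Summable.of_nonneg_of_le (fun n => hfnonneg _) (fun n => (kernel_term_neg_bounds h0 n).2)
      (hS.summable.mul_left _)
  have hneg' : Summable fun n : ℕ => f (-(n + 1)) :=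
    (summable_nat_add_iff (f := fun n : ℕ => f (-(n + 1))) 1).1 hneg
  have hsum := hnat.hasSum.of_nat_of_neg_add_one hneg'.hasSum
  have hsplit : ∑' n : ℕ, f (-(n + 1)) = f (-1) + ∑' n : ℕ, f (-((n + 1 : ℕ) + 1)) := by
    rw [hneg'.tsum_eq_zero_add]
    simp
  have hnatlo : 2 * P ≤ ∑' k : ℕ, f k :=
    hasSum_le (fun k => (kernel_term_nat_bounds h0 k).1) hP hnat.hasSum
  have hnatup : ∑' k : ℕ, f k ≤ 3 * Real.exp 2 * (2 * P) :=
    hasSum_le (fun k => (kernel_term_nat_bounds h0 k).2) hnat.hasSum (hP.mul_left _)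
  have hneglo : S ≤ ∑' n : ℕ, f (-((n + 1 : ℕ) + 1)) :=
    hasSum_le (fun n => (kernel_term_neg_bounds h0 n).1) hS hneg.hasSum
  have hnegup : ∑' n : ℕ, f (-((n + 1 : ℕ) + 1)) ≤ 2 * S :=
    hasSum_le (fun n => (kernel_term_neg_bounds h0 n).2) hneg.hasSum (hS.mul_left _)
  have hP0 : 0 ≤ P := by
    have : 0 < 1 - r ^ 2 := by nlinarith
    positivity
  have hSr : r ^ (-2 : ℤ) ≤ S := by
    have hsinh : 1 / r ≤ Real.sinh (1/r) := Real.self_le_sinh_iff.2 (by positivity)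
    have hone : 1 ≤ 1 / r := (one_le_div h0).2 h1.le
    calc r ^ (-2 : ℤ) = r ^ (-3 : ℤ) * r := by
          rw [← zpow_add_one₀ h0.ne']; norm_num
      _ ≤ S := mul_le_mul_of_nonneg_left (by linarith) (by positivity)
  have hS0 : 0 ≤ S := le_trans (by positivity) hSr
  have hmid : f (-1) ≤ 1 / Iw (-1) * S := by
    have : f (-1) = 1 / Iw (-1) * r ^ (-2 : ℤ) := by
      simp only [hf]
      norm_num
      ring
    rw [this]
    exact mul_le_mul_of_nonneg_left hSr (by positivity)
  have hmid0 := hfnonneg (-1)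
  have hc : 0 ≤ 1 / Iw (-1) := by positivity
  refine ⟨hsum.summable, ?_, ?_⟩
  · rw [hsum.tsum_eq, hsplit]
    refine (mul_le_of_le_one_left (add_nonneg hS0 hP0) ?_).trans (by linarith)
    rw [div_le_one (by positivity)]
    linarith
  · rw [hsum.tsum_eq, hsplit]
    nlinarith [mul_nonneg hc hP0, mul_nonneg he.le hS0]
end
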